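/- arXiv:2311.06514 — 3 statements merged into one kernel-verified Lean document; each statement's English description precedes it below -/
import Mathlib

section
/- The class of data languages accepted by SAFA is not closed under complementation. Specifically, over Σ = {a}: the language L_∃cnt≠2 of data words w in which some data value occurs a number of times different from 2 is accepted by a SAFA, but its complement L_∀cnt=2, the language of data words in which every occurring data value occurs exactly twice, is not accepted by any SAFA. -/
/-- A condition tested by a SAFA transition: membership (`pos h` = `p(h)`)
or non-membership (`neg h` = `!p(h)`) of the current data value in set `h`. -/
inductive SafaCond (H : Type) : Type
  | pos (h : H)
  | neg (h : H)

/-- The set name a condition refers to. -/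
def SafaCond.name {H : Type} : SafaCond H → H
  | .pos h => h
  | .neg h => h

/-- An operation of a SAFA transition: do nothing (`−`) or insert the
current data value into set `h` (`ins(h)`). -/
inductive SafaOp (H : Type) : Type
  | noop
  | ins (h : H)

/-- Whether a condition holds for data value `d` given set contents `s`. -/
def SafaCond.holds {H D : Type} : SafaCond H → D → (H → Set D) → Prop
  | .pos h, d, s => d ∈ s h
  | .neg h, d, s => d ∉ s h

/-- The effect of an operation on the set contents, reading data value `d`. -/
def SafaOp.apply {H D : Type} : SafaOp H → D → (H → Set D) → (H → Set D)
  | .noop, _, s => s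
  | .ins h, d, s => fun j => s j ∪ {x | j = h ∧ x = d}

/-- A transition of a SAFA: source state, attribute, condition, operation, target state. -/
structure SafaTrans (Q A H : Type) : Type where
  src : Q
  attr : A
  cond : SafaCond H
  op : SafaOp H
  dst : Q

/-- A set augmented finite automaton over attributes `A` and data values `D`:
a finite set of states `Q` with initial state `q0` and final states `F`,
a finite collection `H` of set names, and a transition relation `δ`. -/
structure SAFA (A D : Type) : Type 1 where
  Q : Type
  fintypeQ : Fintype Q
  q0 : Q
  F : Set Q
  H : Type
  fintypeH : Fintype H
  δ : Set (SafaTrans Q A H)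

attribute [instance] SAFA.fintypeQ SAFA.fintypeH

namespace SAFA

variable {A D : Type}

/-- A configuration: a state together with the current contents of the sets. -/
abbrev Config (M : SAFA A D) : Type := M.Q × (M.H → Set D)

/-- The initial configuration: initial state, all sets empty. -/
def init (M : SAFA A D) : M.Config := (M.q0, fun _ => ∅)

/-- One step: from configuration `c`, taking transition `t` while reading letter `ad`,
reaching configuration `c'`. -/
def StepVia (M : SAFA A D) (c : M.Config) (t : SafaTrans M.Q A M.H)
    (ad : A × D) (c' : M.Config) : Prop :=
  t ∈ M.δ ∧ t.src = c.1 ∧ t.attr = ad.1 ∧ t.dst = c'.1 ∧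
    t.cond.holds ad.2 c.2 ∧ c'.2 = t.op.apply ad.2 c.2

/-- Execution of a sequence of transitions `T` reading the data word `w`,
from configuration `c` to configuration `c'`. -/
inductive ExecFrom (M : SAFA A D) :
    M.Config → List (SafaTrans M.Q A M.H) → List (A × D) → M.Config → Prop
  | nil (c : M.Config) : ExecFrom M c [] [] c
  | cons {c c' c'' : M.Config} {t : SafaTrans M.Q A M.H}
      {ts : List (SafaTrans M.Q A M.H)} {ad : A × D} {w : List (A × D)} :
      M.StepVia c t ad c' → ExecFrom M c' ts w c'' → ExecFrom M c (t :: ts) (ad :: w) c''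

/-- Acceptance: some run from the initial configuration consumes all of `w`
and ends in a final state. -/
def Accepts (M : SAFA A D) (w : List (A × D)) : Prop :=
  ∃ T c, M.ExecFrom M.init T w c ∧ c.1 ∈ M.F

/-- The data language accepted by `M`. -/
def Lang (M : SAFA A D) : Set (List (A × D)) := {w | M.Accepts w}

/-- A SAFA is deterministic if, for every state and attribute, all outgoing
transitions test membership in one and the same set, with at most one transition
per polarity of the condition. -/
def IsDeterministic (M : SAFA A D) : Prop :=
  ∀ t1 t2 : SafaTrans M.Q A M.H, t1 ∈ M.δ → t2 ∈ M.δ →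
    t1.src = t2.src → t1.attr = t2.attr →
    t1.cond.name = t2.cond.name ∧ (t1.cond = t2.cond → t1 = t2)

end SAFA

namespace SAFA

variable {A D : Type}

/-- Some run from configuration `c` consumes `w` and ends in a final state. -/
def AcceptsFrom (M : SAFA A D) (c : M.Config) (w : List (A × D)) : Prop :=
  ∃ T c', M.ExecFrom c T w c' ∧ c'.1 ∈ M.F

theorem acceptsFrom_nil {M : SAFA A D} {c : M.Config} : M.AcceptsFrom c [] ↔ c.1 ∈ M.F := by
  constructor
  · rintro ⟨T, c', h, hF⟩
    cases h
    exact hF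
  · exact fun h => ⟨[], c, .nil c, h⟩

theorem acceptsFrom_cons {M : SAFA A D} {c : M.Config} {p : A × D} {w : List (A × D)} :
    M.AcceptsFrom c (p :: w) ↔ ∃ t ∈ M.δ, t.src = c.1 ∧ t.attr = p.1 ∧ t.cond.holds p.2 c.2 ∧
      M.AcceptsFrom (t.dst, t.op.apply p.2 c.2) w := by
  constructor
  · rintro ⟨T, c', h, hF⟩
    cases h with
    | @cons _ c₁ _ t _ _ _ hs he =>
      obtain ⟨hδ, hsrc, hattr, hdst, hcond, hop⟩ := hs
      obtain rfl : c₁ = (t.dst, t.op.apply p.2 c.2) := Prod.ext hdst.symm hop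
      exact ⟨t, hδ, hsrc, hattr, hcond, _, _, he, hF⟩
  · rintro ⟨t, hδ, hsrc, hattr, hcond, T, c', he, hF⟩
    exact ⟨t :: T, c', .cons ⟨hδ, hsrc, hattr, rfl, hcond, rfl⟩ he, hF⟩

theorem mem_lang_iff {M : SAFA A D} {w : List (A × D)} :
    w ∈ M.Lang ↔ M.AcceptsFrom M.init w := Iff.rfl

theorem _root_.SafaOp.mem_apply_iff {H : Type} {o : SafaOp H} {d x : D} {s : H → Set D} {h : H} :
    x ∈ o.apply d s h ↔ x ∈ s h ∨ (o = .ins h ∧ x = d) := by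
  cases o with
  | noop => simp [SafaOp.apply]
  | ins k => simp [SafaOp.apply, eq_comm]

theorem _root_.SafaOp.finite_apply {H : Type} (o : SafaOp H) (d : D) {s : H → Set D}
    (hs : ∀ h, (s h).Finite) (h : H) : (o.apply d s h).Finite :=
  ((hs h).insert d).subset fun x hx => by
    rw [SafaOp.mem_apply_iff] at hx
    exact hx.elim Or.inr fun hx => Or.inl hx.2

/-- Acceptance of `w` depends only on the set memberships of the data values of `w`. -/
theorem AcceptsFrom.congr {M : SAFA A D} {w : List (A × D)} {q : M.Q} {s s' : M.H → Set D}
    (hs : ∀ d ∈ w.map Prod.snd, ∀ h, d ∈ s h ↔ d ∈ s' h) (hw : M.AcceptsFrom (q, s) w) :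
    M.AcceptsFrom (q, s') w := by
  induction w generalizing q s s' with
  | nil => exact acceptsFrom_nil.2 (acceptsFrom_nil.1 hw :)
  | cons p w ih =>
    obtain ⟨t, hδ, hsrc, hattr, hcond, hw⟩ := acceptsFrom_cons.1 hw
    refine acceptsFrom_cons.2 ⟨t, hδ, hsrc, hattr, ?_, ih (fun d hd h => ?_) hw⟩
    · have := hs p.2 (by simp)
      revert hcond
      cases t.cond <;> simp [SafaCond.holds, this]
    · simp only [SafaOp.mem_apply_iff, hs d (by simp at hd ⊢; tauto)]

/-- A run on `u ++ v` passes, after `u`, through a configuration with finite sets, from which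
precisely the words accepted there may be used instead of `v`. -/
theorem AcceptsFrom.split {M : SAFA A D} {u v : List (A × D)} {c : M.Config}
    (hc : ∀ h, (c.2 h).Finite) (hw : M.AcceptsFrom c (u ++ v)) :
    ∃ c' : M.Config, (∀ h, (c'.2 h).Finite) ∧ M.AcceptsFrom c' v ∧
      ∀ v', M.AcceptsFrom c' v' → M.AcceptsFrom c (u ++ v') := by
  induction u generalizing c with
  | nil => exact ⟨c, hc, hw, fun _ h => h⟩
  | cons p u ih =>
    obtain ⟨t, hδ, hsrc, hattr, hcond, hw⟩ := acceptsFrom_cons.1 hw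
    obtain ⟨c', hc', hv, h⟩ := ih (c := (t.dst, t.op.apply p.2 c.2)) (t.op.finite_apply p.2 hc) hw
    exact ⟨c', hc', hv, fun v' hv' => acceptsFrom_cons.2 ⟨t, hδ, hsrc, hattr, hcond, h v' hv'⟩⟩

/-- If no letter of an accepted word `v` with distinct data values can be replaced by one that
does not occur later in `v`, then each letter of `v` needs a set name of its own. -/
theorem length_add_card_le [Infinite D] {M : SAFA Unit D} {v : List D} {c : M.Config}
    (hc : ∀ h, (c.2 h).Finite) (hv : v.Nodup) (hacc : M.AcceptsFrom c (v.map (Prod.mk ())))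
    (hrepl : ∀ x d y e, v = x ++ d :: y → e ≠ d → e ∉ y →
      ¬ M.AcceptsFrom c ((x ++ e :: y).map (Prod.mk ())))
    (K : Finset M.H) (hK : ∀ h ∈ K, ∃ e ∉ v, e ∈ c.2 h) :
    v.length + K.card ≤ Fintype.card M.H := by
  classical
  induction v generalizing c K with
  | nil => simpa using K.card_le_univ
  | cons d v ih =>
    obtain ⟨hdv, hv⟩ := List.nodup_cons.1 hv
    obtain ⟨t, hδ, hsrc, hattr, hcond, hacc⟩ := acceptsFrom_cons.1 hacc
    have hfail : ∀ e ≠ d, e ∉ v → ¬ t.cond.holds e c.2 := fun e hed hev he => by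
      refine hrepl [] d v e rfl hed hev (acceptsFrom_cons.2 ⟨t, hδ, hsrc, hattr, he, ?_⟩)
      refine hacc.congr fun x hx h => ?_
      have hx : x ∈ v := by simpa using hx
      have hxd : x ≠ d := fun h => hdv (h ▸ hx)
      have hxe : x ≠ e := fun h => hev (h ▸ hx)
      simp [SafaOp.mem_apply_iff, hxd, hxe]
    obtain ⟨k, hk⟩ : ∃ k, t.cond = .pos k := by
      cases hkc : t.cond with
      | pos k => exact ⟨k, rfl⟩
      | neg k =>
        obtain ⟨e, he⟩ := ((hc k).union (d :: v).finite_toSet).exists_notMem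
        simp only [Set.mem_union, Set.mem_ofPred_eq, List.mem_cons, not_or] at he
        exact (hfail e he.2.1 he.2.2 (by simpa [hkc, SafaCond.holds] using he.1)).elim
    have hkK : k ∉ K := fun h => by
      obtain ⟨e, hev, he⟩ := hK k h
      rw [List.mem_cons, not_or] at hev
      exact hfail e hev.1 hev.2 (by simpa [hk, SafaCond.holds] using he)
    have hdk : d ∈ c.2 k := by simpa [hk, SafaCond.holds] using hcond
    have := ih (c := (t.dst, t.op.apply d c.2)) (t.op.finite_apply d hc) hv hacc
      (fun x d' y e hxy hed hey h => hrepl (d :: x) d' y e (by simp [hxy]) hed hey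
        (acceptsFrom_cons.2 ⟨t, hδ, hsrc, hattr, hcond, h⟩))
      (insert k K) (fun h hh => by
        simp only [SafaOp.mem_apply_iff]
        rcases Finset.mem_insert.1 hh with rfl | hh
        · exact ⟨d, hdv, Or.inl hdk⟩
        · obtain ⟨e, hev, he⟩ := hK h hh
          exact ⟨e, fun h => hev (List.mem_cons_of_mem _ h), Or.inl he⟩)
    rw [Finset.card_insert_of_notMem hkK] at this
    simp only [List.length_cons]
    omega

theorem lang_ne_forall_count_eq_two [Infinite D] [DecidableEq D] (M : SAFA Unit D) :
    M.Lang ≠ {w : List (Unit × D) | ∀ d ∈ w.map Prod.snd, (w.map Prod.snd).count d = 2} := by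
  intro hM
  have hmem : ∀ v : List D, M.AcceptsFrom M.init (v.map (Prod.mk ())) ↔
      ∀ d ∈ v, v.count d = 2 := fun v => by
    rw [← mem_lang_iff, hM]
    simp [Function.comp_def]
  obtain ⟨S, hS⟩ := Infinite.exists_subset_card_eq D (Fintype.card M.H + 1)
  have hnd := S.nodup_toList
  have hlen : S.toList.length = Fintype.card M.H + 1 := by simp [hS]
  generalize S.toList = l at hnd hlen
  have hll : M.AcceptsFrom M.init ((l ++ l).map (Prod.mk ())) := (hmem _).2 fun d hd => by
    have hd : d ∈ l := by simpa using hd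
    simp [List.count_eq_one_of_mem hnd hd]
  rw [List.map_append] at hll
  obtain ⟨c, hc, hacc, hext⟩ := hll.split (fun _ => Set.finite_empty)
  have := length_add_card_le hc hnd hacc (fun x d y e hl hed hey h => by
    have h := hext _ h
    rw [← List.map_append] at h
    have hd : d ∈ l := by simp [hl]
    have h2 := (hmem _).1 h d (by simp [hd])
    have h1 := List.count_eq_one_of_mem hnd hd
    have h1' := h1
    rw [hl] at h1'
    simp only [List.count_append, List.count_cons, h1, beq_iff_eq, hed, if_true, if_false] at h2 h1'
    omega) ∅ (by simp)
  simp at this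
  omega

/-- In state `0` the automaton collects the values read in the set `false`; it may guess that the
current one, not read before, is the witness, put it in the set `true`, and from then on count
its occurrences up to `3` in the state. -/
def existsCountNeTwo (D : Type) : SAFA Unit D where
  Q := Fin 4
  fintypeQ := inferInstance
  q0 := 0
  F := {1, 3}
  H := Bool
  fintypeH := inferInstance
  δ := {t | (t.src = 0 ∧ t.op = .ins false ∧ t.dst = 0) ∨
    (t.src = 0 ∧ t.cond = .neg false ∧ t.op = .ins true ∧ t.dst = 1) ∨
    (t.src ≠ 0 ∧ t.op = .noop ∧ t.cond = .neg true ∧ t.dst = t.src) ∨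
    (t.src ≠ 0 ∧ t.op = .noop ∧ t.cond = .pos true ∧ t.dst = ![1, 2, 3, 3] t.src)}

theorem existsCountNeTwo_acceptsFrom_cons_of_ne_zero {i : Fin 4} (hi : i ≠ 0)
    {s : Bool → Set D} {p : Unit × D} {w : List (Unit × D)} :
    (existsCountNeTwo D).AcceptsFrom (i, s) (p :: w) ↔
      (p.2 ∉ s true ∧ (existsCountNeTwo D).AcceptsFrom (i, s) w) ∨
      (p.2 ∈ s true ∧
        (existsCountNeTwo D).AcceptsFrom ((![1, 2, 3, 3] : Fin 4 → Fin 4) i, s) w) := by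
  rw [acceptsFrom_cons]
  constructor
  · rintro ⟨⟨src, attr, cond, op, dst⟩, hδ, hsrc, -, hcond, hw⟩
    dsimp only at hsrc hcond hw
    subst hsrc
    rcases hδ with h | h | ⟨-, hop, hc, hd⟩ | ⟨-, hop, hc, hd⟩
    · exact (hi h.1).elim
    · exact (hi h.1).elim
    · dsimp only at hop hc hd
      subst hop hc hd
      exact Or.inl ⟨hcond, hw⟩
    · dsimp only at hop hc hd
      subst hop hc hd
      exact Or.inr ⟨hcond, hw⟩
  · rintro (⟨hp, hw⟩ | ⟨hp, hw⟩)
    · exact ⟨⟨i, (), .neg true, .noop, i⟩, .inr (.inr (.inl ⟨hi, rfl, rfl, rfl⟩)),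
        rfl, rfl, hp, hw⟩
    · exact ⟨⟨i, (), .pos true, .noop, _⟩, .inr (.inr (.inr ⟨hi, rfl, rfl, rfl⟩)),
        rfl, rfl, hp, hw⟩

theorem existsCountNeTwo_acceptsFrom_of_ne_zero [DecidableEq D] {i : Fin 4} (hi : i ≠ 0)
    {s : Bool → Set D} {d : D} (hs : s true = {d}) {w : List (Unit × D)} :
    (existsCountNeTwo D).AcceptsFrom (i, s) w ↔ i.val + (w.map Prod.snd).count d ≠ 2 := by
  induction w generalizing i with
  | nil =>
    rw [acceptsFrom_nil]
    change i ∈ ({1, 3} : Set (Fin 4)) ↔ _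
    fin_cases i <;> simp at hi ⊢
  | cons p w ih =>
    have hj : (![1, 2, 3, 3] : Fin 4 → Fin 4) i ≠ 0 := by fin_cases i <;> simp
    rw [existsCountNeTwo_acceptsFrom_cons_of_ne_zero hi, ih hi, ih hj, hs]
    by_cases hp : p.2 = d
    · simp only [hp, Set.mem_singleton_iff, not_true_eq_false, false_and, true_and, false_or,
        List.map_cons, List.count_cons_self]
      fin_cases i <;> simp at hi ⊢ <;> omega
    · simp [hp]

theorem existsCountNeTwo_acceptsFrom_cons_zero {s : Bool → Set D} {p : Unit × D}
    {w : List (Unit × D)} :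
    (existsCountNeTwo D).AcceptsFrom ((0 : Fin 4), s) (p :: w) ↔
      (existsCountNeTwo D).AcceptsFrom ((0 : Fin 4), (SafaOp.ins false).apply p.2 s) w ∨
      (p.2 ∉ s false ∧
        (existsCountNeTwo D).AcceptsFrom ((1 : Fin 4), (SafaOp.ins true).apply p.2 s) w) := by
  rw [acceptsFrom_cons]
  constructor
  · rintro ⟨⟨src, attr, cond, op, dst⟩, hδ, hsrc, -, hcond, hw⟩
    dsimp only at hsrc hcond hw
    subst hsrc
    rcases hδ with ⟨-, hop, hd⟩ | ⟨-, hc, hop, hd⟩ | h | h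
    · dsimp only at hop hd
      subst hop hd
      exact Or.inl hw
    · dsimp only at hop hc hd
      subst hop hc hd
      exact Or.inr ⟨hcond, hw⟩
    · exact (h.1 rfl).elim
    · exact (h.1 rfl).elim
  · rintro (hw | ⟨hp, hw⟩)
    · by_cases hp : p.2 ∈ s false
      · exact ⟨⟨(0 : Fin 4), (), .pos false, .ins false, (0 : Fin 4)⟩, .inl ⟨rfl, rfl, rfl⟩,
          rfl, rfl, hp, hw⟩
      · exact ⟨⟨(0 : Fin 4), (), .neg false, .ins false, (0 : Fin 4)⟩, .inl ⟨rfl, rfl, rfl⟩,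
          rfl, rfl, hp, hw⟩
    · exact ⟨⟨(0 : Fin 4), (), .neg false, .ins true, (1 : Fin 4)⟩,
        .inr (.inl ⟨rfl, rfl, rfl, rfl⟩), rfl, rfl, hp, hw⟩

theorem existsCountNeTwo_acceptsFrom_zero [DecidableEq D] {s : Bool → Set D}
    (hs : s true = ∅) {w : List (Unit × D)} :
    (existsCountNeTwo D).AcceptsFrom ((0 : Fin 4), s) w ↔
      ∃ d ∈ w.map Prod.snd, d ∉ s false ∧ (w.map Prod.snd).count d ≠ 2 := by
  induction w generalizing s with
  | nil =>
    rw [acceptsFrom_nil]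
    change (0 : Fin 4) ∈ ({1, 3} : Set (Fin 4)) ↔ _
    simp
  | cons p w ih =>
    have h0 : (SafaOp.ins false).apply p.2 s true = ∅ := by simp [SafaOp.apply, hs]
    have h1 : (SafaOp.ins true).apply p.2 s true = {p.2} := by simp [SafaOp.apply, hs]
    rw [existsCountNeTwo_acceptsFrom_cons_zero, ih h0,
      existsCountNeTwo_acceptsFrom_of_ne_zero (by decide) h1]
    simp only [SafaOp.mem_apply_iff, true_and, not_or, List.map_cons, List.mem_cons]
    constructor
    · rintro (⟨d, hd, ⟨hds, hdp⟩, hc⟩ | ⟨hp, hc⟩)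
      · exact ⟨d, .inr hd, hds, by rwa [List.count_cons_of_ne (Ne.symm hdp)]⟩
      · exact ⟨p.2, .inl rfl, hp, by rw [List.count_cons_self]; simpa [add_comm] using hc⟩
    · rintro ⟨d, hd, hds, hc⟩
      by_cases hdp : d = p.2
      · subst hdp
        exact .inr ⟨hds, by rw [List.count_cons_self] at hc; simpa [add_comm] using hc⟩
      · rw [List.count_cons_of_ne (Ne.symm hdp)] at hc
        exact .inl ⟨d, hd.resolve_left hdp, ⟨hds, hdp⟩, hc⟩

theorem lang_existsCountNeTwo [DecidableEq D] : (existsCountNeTwo D).Lang =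
    {w : List (Unit × D) | ∃ d, d ∈ w.map Prod.snd ∧ (w.map Prod.snd).count d ≠ 2} := by
  ext w
  rw [mem_lang_iff]
  refine (existsCountNeTwo_acceptsFrom_zero rfl).trans ?_
  simp

end SAFA

/-- SAFA languages are not closed under complementation: over a one-letter
alphabet, the language of data words in which some occurring data value occurs a number
of times ≠ 2 is a SAFA language; its complement, the language of data words in which
every occurring data value occurs exactly twice, is not. -/
theorem safa_not_closed_complement {D : Type} [Countable D] [Infinite D] [DecidableEq D] :
    (∃ M : SAFA Unit D, M.Lang =
        {w : List (Unit × D) | ∃ d, d ∈ w.map Prod.snd ∧ (w.map Prod.snd).count d ≠ 2}) ∧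
    ({w : List (Unit × D) | ∀ d ∈ w.map Prod.snd, (w.map Prod.snd).count d = 2} =
        {w : List (Unit × D) | ∃ d, d ∈ w.map Prod.snd ∧ (w.map Prod.snd).count d ≠ 2}ᶜ) ∧
    ¬ ∃ M : SAFA Unit D, M.Lang =
        {w : List (Unit × D) | ∀ d ∈ w.map Prod.snd, (w.map Prod.snd).count d = 2} := by
  refine ⟨⟨_, SAFA.lang_existsCountNeTwo⟩, ?_, fun ⟨M, hM⟩ => M.lang_ne_forall_count_eq_two hM⟩
  ext w
  simp only [Set.mem_ofPred_eq, Set.mem_compl_iff, not_exists, not_and, not_not]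
end

section
/- The class of data languages accepted by SAFA is not closed under reversal. Specifically, over Σ = {a, b}: the language L_a∃b (all data words in which every occurrence of a data value with attribute a is preceded at an earlier position by an occurrence of the same data value with attribute b) is accepted by a (deterministic) SAFA, but its reversal L = { w^R : w ∈ L_a∃b } is not accepted by any SAFA. -/
/-- L_a∃b over Σ = Fin 2 (a = 0, b = 1): every occurrence of a data value with
attribute a is preceded at an earlier position by the same data value with attribute b. -/
def LaExistsB (D : Type) : Set (List (Fin 2 × D)) :=
  {w | ∀ i : Fin w.length, (w.get i).1 = 0 →
        ∃ j : Fin w.length, (j : ℕ) < (i : ℕ) ∧ w.get j = (1, (w.get i).2)}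

namespace SAFA

variable {A D : Type}

/-- Splitting an execution at a concatenation point. -/
theorem ExecFrom.split {M : SAFA A D} {u v : List (A × D)} {c c' : M.Config}
    {T : List (SafaTrans M.Q A M.H)} (h : M.ExecFrom c T (u ++ v) c') :
    ∃ T₁ T₂ c₁, M.ExecFrom c T₁ u c₁ ∧ M.ExecFrom c₁ T₂ v c' := by
  induction u generalizing c T with
  | nil => exact ⟨[], T, c, .nil c, h⟩
  | cons x u ih =>
    cases h with
    | cons hs he =>
      obtain ⟨T₁, T₂, c₁, h₁, h₂⟩ := ih he
      exact ⟨_, T₂, c₁, .cons hs h₁, h₂⟩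

theorem ExecFrom.append {M : SAFA A D} {u v : List (A × D)} {c c₁ c' : M.Config}
    {T₁ T₂ : List (SafaTrans M.Q A M.H)} (h₁ : M.ExecFrom c T₁ u c₁)
    (h₂ : M.ExecFrom c₁ T₂ v c') : M.ExecFrom c (T₁ ++ T₂) (u ++ v) c' := by
  induction h₁ with
  | nil => exact h₂
  | cons hs _ ih => exact .cons hs (ih h₂)

theorem _root_.SafaOp.mem_apply_of_ne {H : Type} (op : SafaOp H) {x d : D} (hx : x ≠ d)
    (s : H → Set D) (k : H) : x ∈ op.apply d s k ↔ x ∈ s k := by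
  cases op <;> simp [SafaOp.apply, hx]

theorem _root_.SafaOp.mem_apply_congr {H : Type} (op : SafaOp H) {x d : D} {s s' : H → Set D}
    (hs : ∀ k, x ∈ s k ↔ x ∈ s' k) (k : H) : x ∈ op.apply d s k ↔ x ∈ op.apply d s' k := by
  cases op <;> simp [SafaOp.apply, hs]

theorem _root_.SafaCond.holds_congr {H : Type} (cd : SafaCond H) {d : D} {s s' : H → Set D}
    (hs : ∀ k, d ∈ s k ↔ d ∈ s' k) : cd.holds d s ↔ cd.holds d s' := by
  cases cd <;> simp [SafaCond.holds, hs]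

/-- The sets a data value belongs to do not change while that value is not read. -/
theorem ExecFrom.mem_iff_of_notMem {M : SAFA A D} {w : List (A × D)} {c c' : M.Config}
    {T : List (SafaTrans M.Q A M.H)} (h : M.ExecFrom c T w c') {d : D}
    (hd : d ∉ w.map Prod.snd) (k : M.H) : d ∈ c'.2 k ↔ d ∈ c.2 k := by
  induction h with
  | nil => rfl
  | cons hs _ ih =>
    simp only [List.map_cons, List.mem_cons, not_or] at hd
    rw [ih hd.2, hs.2.2.2.2.2, SafaOp.mem_apply_of_ne _ hd.1]

/-- An execution only depends on the memberships of the data values it reads. -/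
theorem ExecFrom.congr {M : SAFA A D} {w : List (A × D)} {c c' : M.Config}
    {T : List (SafaTrans M.Q A M.H)} (h : M.ExecFrom c T w c') {e : M.Config}
    (hq : e.1 = c.1) (hm : ∀ d ∈ w.map Prod.snd, ∀ k, d ∈ e.2 k ↔ d ∈ c.2 k) :
    ∃ e', M.ExecFrom e T w e' ∧ e'.1 = c'.1 := by
  induction h generalizing e with
  | nil => exact ⟨e, .nil e, hq⟩
  | @cons c c₁ c' t ts ad w hs _ ih =>
    obtain ⟨ht, hsrc, hattr, hdst, hc, hop⟩ := hs
    obtain ⟨e', he, hq'⟩ := @ih (c₁.1, t.op.apply ad.2 e.2) rfl (by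
      intro d hd k
      rw [hop]
      exact SafaOp.mem_apply_congr _ (hm d (List.mem_cons_of_mem _ hd)) k)
    exact ⟨e', .cons (c' := (c₁.1, t.op.apply ad.2 e.2)) ⟨ht, hsrc.trans hq.symm, hattr, hdst,
      (SafaCond.holds_congr _ (hm ad.2 List.mem_cons_self)).2 hc, rfl⟩ he, hq'⟩

/-- The pumping-down argument: when distinct data values are read one after another, some
nonempty segment of the reading can be dropped without affecting the state that is reached. -/
theorem ExecFrom.exists_shorter {M : SAFA A D} {a : A} {l : List D} (hl : l.Nodup)
    (hlen : Fintype.card M.Q ≤ l.length) {c c' : M.Config} {T : List (SafaTrans M.Q A M.H)}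
    (h : M.ExecFrom c T (l.map (Prod.mk a)) c') :
    ∃ i j, i < j ∧ j ≤ l.length ∧ ∃ T' e,
      M.ExecFrom c T' ((l.take i ++ l.drop j).map (Prod.mk a)) e ∧ e.1 = c'.1 := by
  have hsplit (i : ℕ) : ∃ T₁ T₂ c₁, M.ExecFrom c T₁ ((l.take i).map (Prod.mk a)) c₁ ∧
      M.ExecFrom c₁ T₂ ((l.drop i).map (Prod.mk a)) c' := by
    apply ExecFrom.split (T := T)
    rwa [← List.map_append, List.take_append_drop]
  choose T₁ T₂ f h₁ h₂ using hsplit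
  obtain ⟨x, y, hne, hxy⟩ := Fintype.exists_ne_map_eq_of_card_lt
    (fun i : Fin (l.length + 1) => (f i).1) (by simpa using Nat.lt_succ_of_le hlen)
  wlog hlt : x < y generalizing x y
  · exact this y x hne.symm hxy.symm (lt_of_le_of_ne (not_lt.1 hlt) hne.symm)
  have hlt' : (x : ℕ) < y := hlt
  refine ⟨x, y, hlt', Nat.lt_succ_iff.1 y.2, ?_⟩
  have hdisj (d : D) (hd : d ∈ l.drop y) (i : ℕ) (hi : i ≤ y) (k : M.H) :
      d ∈ (f i).2 k ↔ d ∈ c.2 k := by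
    apply (h₁ i).mem_iff_of_notMem
    simp only [List.map_map, Function.comp_def, List.map_id']
    exact fun hd' => List.disjoint_take_drop hl hi hd' hd
  obtain ⟨e, he, hq⟩ := (h₂ y).congr hxy (by
    intro d hd k
    simp only [List.map_map, Function.comp_def, List.map_id'] at hd
    rw [hdisj d hd x hlt'.le, hdisj d hd y le_rfl])
  exact ⟨_, e, by rw [List.map_append]; exact (h₁ x).append he, hq⟩

/-- The deterministic SAFA for `LaExistsB`: it collects the values read with attribute `1` and
requires the values read with attribute `0` to have been collected. -/
def laExistsB (D : Type) : SAFA (Fin 2) D where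
  Q := Unit
  fintypeQ := inferInstance
  q0 := ()
  F := Set.univ
  H := Unit
  fintypeH := inferInstance
  δ := {t | t.attr = 1 ∧ t.op = .ins () ∨ t.attr = 0 ∧ t.cond = .pos () ∧ t.op = .noop}

theorem isDeterministic_laExistsB (D : Type) : (laExistsB D).IsDeterministic := by
  rintro ⟨s, a, cd, op, q⟩ ⟨s', a', cd', op', q'⟩ h h' _ hattr
  refine ⟨rfl, fun hc => ?_⟩
  simp only at hattr hc
  subst hattr hc
  have hop : op = op' := by
    rcases h with ⟨h, ho⟩ | ⟨h, -, ho⟩ <;> rcases h' with ⟨h', ho'⟩ | ⟨h', -, ho'⟩ <;>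
      first | exact ho.trans ho'.symm | simp_all
  rw [hop]
  rfl

theorem exists_execFrom_laExistsB_iff (w : List (Fin 2 × D)) (c : (laExistsB D).Config) :
    (∃ T c', (laExistsB D).ExecFrom c T w c') ↔
      ∀ u d v, w = u ++ (0, d) :: v → (1, d) ∈ u ∨ d ∈ c.2 () := by
  induction w generalizing c with
  | nil => exact ⟨fun _ => by simp, fun _ => ⟨[], c, .nil c⟩⟩
  | cons x w ih =>
    obtain ⟨a, e⟩ := x
    constructor
    · rintro ⟨_, c', h⟩ u d v huv
      cases h with
      | @cons _ c₁ _ t ts _ _ hs he =>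
        obtain ⟨ht, -, hattr, -, hc, hop⟩ := hs
        have hw := (ih c₁).1 ⟨_, _, he⟩
        cases u with
        | nil =>
          simp only [List.nil_append, List.cons.injEq, Prod.mk.injEq] at huv
          obtain ⟨⟨rfl, rfl⟩, -⟩ := huv
          rcases ht with ⟨h1, -⟩ | ⟨-, h1, -⟩
          · simp [h1] at hattr
          · rw [h1] at hc
            exact .inr hc
        | cons y u =>
          simp only [List.cons_append, List.cons.injEq] at huv
          obtain ⟨rfl, rfl⟩ := huv
          rcases hw u d v rfl with h | h
          · exact .inl (List.mem_cons_of_mem _ h)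
          · rw [hop] at h
            rcases ht with ⟨h1, h2⟩ | ⟨-, -, h2⟩
            · rw [h2] at h
              rcases h with h | ⟨-, rfl⟩
              · exact .inr h
              · left
                simp only at hattr
                simp [← hattr, h1]
            · rw [h2] at h
              exact .inr h
    · intro h
      by_cases ha : a = 0
      · subst ha
        have he : e ∈ c.2 () := by simpa using h [] e w rfl
        obtain ⟨T, c', hT⟩ := (ih c).2 (by
          rintro u d v rfl
          rcases h ((0, e) :: u) d v rfl with h | h
          · left; simpa using h
          · exact .inr h)
        exact ⟨⟨(), 0, .pos (), .noop, ()⟩ :: T, c',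
          .cons ⟨.inr ⟨rfl, rfl, rfl⟩, rfl, rfl, rfl, he, rfl⟩ hT⟩
      · obtain rfl : a = 1 := by omega
        obtain ⟨T, c', hT⟩ := (ih ((), SafaOp.apply (.ins ()) e c.2)).2 (by
          rintro u d v rfl
          rcases h ((1, e) :: u) d v rfl with h | h
          · rcases List.mem_cons.1 h with h | h
            · right; right; exact ⟨rfl, (Prod.mk.inj h).2⟩
            · exact .inl h
          · exact .inr (.inl h))
        by_cases he : e ∈ c.2 ()
        · exact ⟨⟨(), 1, .pos (), .ins (), ()⟩ :: T, c',
            .cons ⟨.inl ⟨rfl, rfl⟩, rfl, rfl, rfl, he, rfl⟩ hT⟩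
        · exact ⟨⟨(), 1, .neg (), .ins (), ()⟩ :: T, c',
            .cons ⟨.inl ⟨rfl, rfl⟩, rfl, rfl, rfl, he, rfl⟩ hT⟩

end SAFA

theorem mem_LaExistsB_iff {D : Type} (w : List (Fin 2 × D)) :
    w ∈ LaExistsB D ↔ ∀ u d v, w = u ++ (0, d) :: v → (1, d) ∈ u := by
  constructor
  · rintro h u d v rfl
    obtain ⟨j, hj, hw⟩ := h ⟨u.length, by simp⟩ (by simp)
    simp only at hj
    simp only [List.get_eq_getElem, List.getElem_append_left hj] at hw
    have := List.getElem_mem hj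
    rw [hw] at this
    simpa using this
  · intro h i hi
    obtain ⟨i, hlt⟩ := i
    have hmem := h (w.take i) w[i].2 (w.drop (i + 1)) (by
      have : (0, w[i].2) = w[i] := Prod.ext hi.symm rfl
      rw [this, List.cons_getElem_drop_succ, List.take_append_drop])
    obtain ⟨j, hj, hw⟩ := List.getElem_of_mem hmem
    rw [List.length_take] at hj
    exact ⟨⟨j, by omega⟩, by simp only; omega, by simpa using hw⟩

theorem SAFA.lang_laExistsB (D : Type) : (SAFA.laExistsB D).Lang = LaExistsB D := by
  ext w
  rw [mem_LaExistsB_iff]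
  have h := SAFA.exists_execFrom_laExistsB_iff w (SAFA.laExistsB D).init
  simp only [SAFA.init, Set.mem_empty_iff_false, or_false] at h
  rw [← h]
  exact ⟨fun ⟨T, c, hT, _⟩ => ⟨T, c, hT⟩, fun ⟨T, c, hT⟩ => ⟨T, c, hT, trivial⟩⟩

/-- SAFA languages are not closed under reversal: L_a∃b is accepted by a
deterministic SAFA, but its reversal { w^R : w ∈ L_a∃b } is not accepted by any SAFA. -/
theorem safa_not_closed_reversal {D : Type} [Countable D] [Infinite D] :
    (∃ M : SAFA (Fin 2) D, M.IsDeterministic ∧ M.Lang = LaExistsB D) ∧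
    ¬ ∃ M : SAFA (Fin 2) D, M.Lang = List.reverse '' LaExistsB D := by
  refine ⟨⟨SAFA.laExistsB D, SAFA.isDeterministic_laExistsB D, SAFA.lang_laExistsB D⟩, ?_⟩
  rintro ⟨M, hM⟩
  obtain ⟨s, hs⟩ := Infinite.exists_subset_card_eq D (Fintype.card M.Q)
  set l := s.toList
  have hl : l.Nodup := s.nodup_toList
  have hlen : l.length = Fintype.card M.Q := by rw [Finset.length_toList, hs]
  have hmem : l.map (Prod.mk 0) ++ l.map (Prod.mk 1) ∈ M.Lang := by
    rw [hM]
    refine ⟨_, ?_, List.reverse_reverse _⟩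
    rw [mem_LaExistsB_iff]
    intro u d v huv
    have hd : d ∈ l := by
      have : ((0 : Fin 2), d) ∈ u ++ (0, d) :: v := by simp
      rw [← huv] at this
      simpa using this
    rw [List.reverse_append] at huv
    rcases List.append_eq_append_iff.1 huv with ⟨z, rfl, -⟩ | ⟨z, hz, hz'⟩
    · simp [hd]
    · cases z with
      | nil =>
        rw [List.append_nil] at hz
        simp [← hz, hd]
      | cons y z =>
        have hy : y = (0, d) := (List.cons.inj hz').1.symm
        have : ((0 : Fin 2), d) ∈ (l.map (Prod.mk (1 : Fin 2))).reverse := by simp [hz, hy]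
        simp at this
  obtain ⟨T, c', hT, hF⟩ := hmem
  obtain ⟨T₁, T₂, c, h₁, h₂⟩ := hT.split
  obtain ⟨i, j, hij, hj, T', e, he, hq⟩ := h₂.exists_shorter hl hlen.ge
  have hacc : l.map (Prod.mk 0) ++ (l.take i ++ l.drop j).map (Prod.mk 1) ∈ M.Lang :=
    ⟨_, e, h₁.append he, hq ▸ hF⟩
  rw [hM] at hacc
  obtain ⟨w, hw, hrev⟩ := hacc
  rw [mem_LaExistsB_iff] at hw
  have hi : i < l.length := by omega
  have h0 : ((0 : Fin 2), l[i]) ∈ w := by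
    rw [← List.mem_reverse, hrev]
    simp
  obtain ⟨u, v, rfl⟩ := List.append_of_mem h0
  have h1 : ((1 : Fin 2), l[i]) ∈ (u ++ (0, l[i]) :: v).reverse := by
    simp [hw u _ v rfl]
  rw [hrev] at h1
  have h1' : l[i] ∈ l.take i ∨ l[i] ∈ l.drop j := by
    simpa [-List.map_take, -List.map_drop] using h1
  rcases h1' with h | h
  · refine List.disjoint_take_drop hl le_rfl h ?_
    rw [← List.cons_getElem_drop_succ (h := hi)]
    exact List.mem_cons_self
  · refine List.disjoint_take_drop hl hij ?_ h
    rw [List.take_succ_eq_append_getElem hi]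
    exact List.mem_append_right _ List.mem_cons_self
end

section
/- The class of data languages accepted by SAFA is not closed under homomorphism. Specifically, over Σ = {a} and D = ℕ, let h be the monoid homomorphism on data words determined by h((a,d)) = (a,d)(a,d) for all d ∈ ℕ. The language L_fd(a) of data words whose data values are pairwise distinct is accepted by a SAFA, but h(L_fd(a)) — the language of data words in which every data value occurs exactly twice and in two consecutive positions — is not accepted by any SAFA. -/
namespace SafaOp

variable {H D : Type}

theorem subset_apply (o : SafaOp H) (d : D) (s : H → Set D) (h : H) : s h ⊆ o.apply d s h := by
  cases o with
  | noop => exact subset_rfl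
  | ins k => exact Set.subset_union_left

theorem mem_apply_iff_of_ne (o : SafaOp H) {d y : D} (hy : y ≠ d) (s : H → Set D) (h : H) :
    y ∈ o.apply d s h ↔ y ∈ s h := by
  cases o <;> simp [SafaOp.apply, hy]

theorem mem_apply_congr_s10 (o : SafaOp H) (d : D) {y : D} {s s' : H → Set D}
    (hs : ∀ h, y ∈ s h ↔ y ∈ s' h) (h : H) : y ∈ o.apply d s h ↔ y ∈ o.apply d s' h := by
  cases o <;> simp [SafaOp.apply, hs]

end SafaOp

theorem SafaCond.holds_congr_s10 {H D : Type} (c : SafaCond H) {d : D} {s s' : H → Set D}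
    (hs : ∀ h, d ∈ s h ↔ d ∈ s' h) : c.holds d s ↔ c.holds d s' := by
  cases c <;> simp [SafaCond.holds, hs]

/-- Repeat every letter of a word twice in a row. -/
def doubleLetters {α : Type} (w : List α) : List α := w.flatMap fun p => [p, p]

@[simp]
theorem doubleLetters_cons {α : Type} (a : α) (w : List α) :
    doubleLetters (a :: w) = a :: a :: doubleLetters w := rfl

@[simp]
theorem mem_doubleLetters {α : Type} {a : α} {w : List α} : a ∈ doubleLetters w ↔ a ∈ w := by
  simp [doubleLetters]

theorem eq_of_doubleLetters_append_eq {α : Type} {a b : α} {v : List α} :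
    ∀ {u w : List α}, doubleLetters u ++ a :: b :: v = doubleLetters w → a = b
  | [], [], h => by simp [doubleLetters] at h
  | [], c :: w, h => by
    simp only [doubleLetters, List.flatMap_nil, List.nil_append, List.flatMap_cons,
      List.cons_append, List.cons.injEq] at h
    exact h.1.trans h.2.1.symm
  | _ :: _, [], h => by simp [doubleLetters] at h
  | d :: u, c :: w, h => by
    simp only [doubleLetters_cons, List.cons_append, List.cons.injEq] at h
    exact eq_of_doubleLetters_append_eq h.2.2

namespace SAFA

variable {A D : Type} {M : SAFA A D}

theorem ExecFrom.append_s10 {c c' c'' : M.Config} {T T' : List (SafaTrans M.Q A M.H)}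
    {w w' : List (A × D)} (h : M.ExecFrom c T w c') (hnext : M.ExecFrom c' T' w' c'') :
    M.ExecFrom c (T ++ T') (w ++ w') c'' := by
  induction h with
  | nil => exact hnext
  | cons hs _ ih => exact .cons hs (ih hnext)

/-- A run only depends on the membership in the sets of the values it reads. -/
theorem ExecFrom.congr_s10 {c c' : M.Config} {T : List (SafaTrans M.Q A M.H)} {w : List (A × D)}
    (h : M.ExecFrom c T w c') (s : M.H → Set D)
    (hs : ∀ p ∈ w, ∀ k, p.2 ∈ c.2 k ↔ p.2 ∈ s k) :
    ∃ s', M.ExecFrom (c.1, s) T w (c'.1, s') := by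
  induction h generalizing s with
  | nil => exact ⟨s, .nil _⟩
  | @cons c c₁ c₂ t ts ad w hst _ ih =>
    obtain ⟨hδ, hsrc, hattr, hdst, hc, hop⟩ := hst
    obtain ⟨s', hrun⟩ := ih (t.op.apply ad.2 s) fun p hp k => by
      rw [hop]
      exact t.op.mem_apply_congr_s10 _ (hs p (List.mem_cons_of_mem _ hp)) k
    exact ⟨s', .cons (c' := (c₁.1, t.op.apply ad.2 s)) ⟨hδ, hsrc, hattr, hdst,
      (t.cond.holds_congr_s10 (hs ad List.mem_cons_self)).1 hc, rfl⟩ hrun⟩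

/-- Sets are only ever filled with values that have been read. -/
theorem ExecFrom.mem_read {c c' : M.Config} {T : List (SafaTrans M.Q A M.H)}
    {w : List (A × D)} (h : M.ExecFrom c T w c') {y : D} {k : M.H} (hy : y ∈ c'.2 k) :
    y ∈ c.2 k ∨ y ∈ w.map Prod.snd := by
  induction h with
  | nil => exact .inl hy
  | @cons c c₁ c₂ t ts ad w hst _ ih =>
    by_cases hd : y = ad.2
    · simp [hd]
    · rcases ih hy with h | h
      · rw [hst.2.2.2.2.2, t.op.mem_apply_iff_of_ne hd] at h
        exact .inl h
      · exact .inr (List.mem_cons_of_mem _ h)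

/-- If every accepted word is a doubled word, then in an accepting run over a doubled word with
distinct values, every letter pair fills a previously empty set. -/
theorem length_le_ncard_empty [Infinite D] (hM : M.Lang ⊆ Set.range doubleLetters)
    {c' : M.Config} (hF : c'.1 ∈ M.F) (v : List (A × D)) :
    ∀ (u : List (A × D)) (c : M.Config) (T₀ T : List (SafaTrans M.Q A M.H)),
      M.ExecFrom M.init T₀ (doubleLetters u) c → M.ExecFrom c T (doubleLetters v) c' →
      ((u ++ v).map Prod.snd).Nodup → v.length ≤ {k | c.2 k = ∅}.ncard := by
  induction v with
  | nil => simp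
  | cons p v ih =>
    intro u c T₀ T hu hv hnd
    obtain ⟨a, d⟩ := p
    cases hv with
    | @cons _ c₁ _ t T₁ _ _ ht hv =>
    cases hv with
    | @cons _ c₂ _ t' T₂ _ _ ht' hv =>
    have hlen := ih (u ++ [(a, d)]) c₂ (T₀ ++ [t, t']) T₂
      (by simpa [doubleLetters] using hu.append_s10 (.cons ht (.cons ht' (.nil _)))) hv
      (by simpa using hnd)
    have hread {y : D} {k : M.H} (hy : y ∈ c.2 k) : y ∈ u.map Prod.snd := by
      have := hu.mem_read hy
      simpa [init] using this
    simp only [List.map_append, List.map_cons, List.nodup_append, List.nodup_cons] at hnd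
    obtain ⟨-, ⟨hdv, -⟩, hdisj⟩ := hnd
    have hswap (x : D) (hxd : x ≠ d) (hxv : x ∉ v.map Prod.snd) : ¬ t'.cond.holds x c₁.2 := by
      intro hx
      obtain ⟨s', hs'⟩ := hv.congr_s10 (t'.op.apply x c₁.2) fun q hq k => by
        have hq : q.2 ∈ v.map Prod.snd := List.mem_map_of_mem (mem_doubleLetters.1 hq)
        rw [ht'.2.2.2.2.2, t'.op.mem_apply_iff_of_ne (ne_of_mem_of_not_mem hq hdv),
          t'.op.mem_apply_iff_of_ne (ne_of_mem_of_not_mem hq hxv)]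
      have hstep : M.StepVia c₁ t' (a, x) (c₂.1, t'.op.apply x c₁.2) :=
        ⟨ht'.1, ht'.2.1, ht'.2.2.1, ht'.2.2.2.1, hx, rfl⟩
      obtain ⟨w, hw⟩ := hM ⟨_, _, hu.append_s10 (.cons ht (.cons hstep hs')), hF⟩
      exact hxd (congrArg Prod.snd (eq_of_doubleLetters_append_eq hw.symm)).symm
    obtain ⟨k, hk, hk₁⟩ : ∃ k, c.2 k = ∅ ∧ d ∈ c₁.2 k := by
      have hcond := ht'.2.2.2.2.1
      match hc : t'.cond with
      | .pos k =>
        rw [hc] at hcond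
        refine ⟨k, Set.eq_empty_of_forall_notMem fun x hx => ?_, hcond⟩
        have hxu := hread hx
        refine hswap x (hdisj x hxu d List.mem_cons_self)
          (fun hxv => hdisj x hxu x (List.mem_cons_of_mem _ hxv) rfl) ?_
        rw [hc, ht.2.2.2.2.2]
        exact t.op.subset_apply d c.2 k hx
      | .neg k =>
        classical
        obtain ⟨x, hx⟩ := Infinite.exists_notMem_finset
          (u.map Prod.snd ++ d :: v.map Prod.snd).toFinset
        simp only [List.mem_toFinset, List.mem_append, List.mem_cons, not_or] at hx
        refine absurd ?_ (hswap x hx.2.1 hx.2.2)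
        rw [hc, ht.2.2.2.2.2]
        exact fun h => hx.1 (hread ((t.op.mem_apply_iff_of_ne hx.2.1 _ _).1 h))
    have hmono (j : M.H) : c₁.2 j ⊆ c₂.2 j := by
      rw [ht'.2.2.2.2.2]
      exact t'.op.subset_apply d c₁.2 j
    have hmono' (j : M.H) : c.2 j ⊆ c₂.2 j := by
      refine subset_trans ?_ (hmono j)
      rw [ht.2.2.2.2.2]
      exact t.op.subset_apply d c.2 j
    have hlt : {k | c₂.2 k = ∅}.ncard < {k | c.2 k = ∅}.ncard := by
      refine Set.ncard_lt_ncard (Set.ssubset_iff_of_subset ?_ |>.2 ⟨k, hk, ?_⟩) (Set.toFinite _)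
      · exact fun j hj => Set.subset_eq_empty (hmono' j) hj
      · exact fun h => Set.notMem_empty d (h ▸ hmono k hk₁)
    simp only [List.length_cons]
    omega

/-- The SAFA that stores every value it reads and rejects repeated values. -/
def freshData (D : Type) : SAFA Unit D where
  Q := Unit
  fintypeQ := inferInstance
  q0 := ()
  F := Set.univ
  H := Unit
  fintypeH := inferInstance
  δ := {⟨(), (), .neg (), .ins (), ()⟩}

theorem exists_execFrom_freshData_iff (w : List (Unit × D)) :
    ∀ s : Unit → Set D, (∃ T c, (freshData D).ExecFrom ((), s) T w c) ↔
      (w.map Prod.snd).Nodup ∧ ∀ y ∈ w.map Prod.snd, y ∉ s () := by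
  induction w with
  | nil => exact fun s => ⟨fun _ => by simp, fun _ => ⟨[], _, .nil _⟩⟩
  | cons p w ih =>
    intro s
    have key : (∃ T c, (freshData D).ExecFrom ((), s) T (p :: w) c) ↔
        p.2 ∉ s () ∧ ∃ T c, (freshData D).ExecFrom
          ((), (SafaOp.ins ()).apply p.2 s) T w c := by
      constructor
      · rintro ⟨_, c, h⟩
        cases h with
        | @cons _ c₁ _ t T _ _ ht h =>
        obtain ⟨rfl, -, -, -, hc, hop⟩ := ht
        obtain ⟨q, s₁⟩ := c₁
        obtain rfl : s₁ = _ := hop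
        exact ⟨hc, T, c, h⟩
      · rintro ⟨hp, T, c, h⟩
        exact ⟨_, c, .cons ⟨rfl, rfl, rfl, rfl, hp, rfl⟩ h⟩
    rw [key, ih]
    simp only [SafaOp.apply, List.map_cons, List.nodup_cons, List.forall_mem_cons,
      Set.mem_union, Set.mem_ofPred_eq, true_and, not_or]
    constructor
    · rintro ⟨hp, hn, hw⟩
      exact ⟨⟨fun h => (hw _ h).2 rfl, hn⟩, hp, fun y hy => (hw y hy).1⟩
    · rintro ⟨⟨hpw, hn⟩, hp, hw⟩
      exact ⟨hp, hn, fun y hy => ⟨hw y hy, ne_of_mem_of_not_mem hy hpw⟩⟩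

theorem lang_freshData : (freshData D).Lang = {w | (w.map Prod.snd).Nodup} := by
  ext w
  have := exists_execFrom_freshData_iff w fun _ => ∅
  simp only [Set.mem_empty_iff_false, not_false_eq_true, implies_true, and_true] at this
  rw [Set.mem_ofPred_eq, ← this]
  exact ⟨fun ⟨T, c, h, _⟩ => ⟨T, c, h⟩, fun ⟨T, c, h⟩ => ⟨T, c, h, Set.mem_univ _⟩⟩

end SAFA

/-- SAFA languages are not closed under homomorphism: over Σ = {a}, D = ℕ,
with h((a,d)) = (a,d)(a,d), the language L_fd(a) of data words with pairwise distinct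
data values is a SAFA language, but its image h(L_fd(a)) is not. -/
theorem safa_not_closed_hom :
    (∃ M : SAFA Unit ℕ, M.Lang = {w : List (Unit × ℕ) | (w.map Prod.snd).Nodup}) ∧
    ¬ ∃ M : SAFA Unit ℕ, M.Lang =
        (fun w : List (Unit × ℕ) => w.flatMap fun p => [p, p]) ''
          {w : List (Unit × ℕ) | (w.map Prod.snd).Nodup} := by
  refine ⟨⟨SAFA.freshData ℕ, SAFA.lang_freshData⟩, ?_⟩
  rintro ⟨M, hM⟩
  let v : List (Unit × ℕ) := (List.range (Nat.card M.H + 1)).map fun n => ((), n)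
  have hv : (v.map Prod.snd).Nodup := by
    simpa [v, Function.comp_def] using List.nodup_range
  obtain ⟨T, c, hT, hF⟩ : doubleLetters v ∈ M.Lang := hM ▸ ⟨v, hv, rfl⟩
  have hlen := SAFA.length_le_ncard_empty (hM.trans_subset (Set.image_subset_range _ _)) hF v []
    M.init [] T (.nil _) hT hv
  have hcard := Set.ncard_le_card {k | M.init.2 k = ∅}
  simp only [v, List.length_map, List.length_range] at hlen
  omega
end
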